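/- Let s ∈ (0,1) and let u(x) = ((x·ν)_+)^s for a unit vector ν ∈ ℝⁿ. Then for every operator L in the class L_*(s), Lu(x) = 0 for all x with x·ν > 0. -/

import Mathlib

open MeasureTheory
open scoped RealInnerProductSpace

/-- A spectral measure `μ` (restricted to the unit sphere) belongs to the class `L_*`
with ellipticity constants `lam ≤ Lam`: it is measurable, even, and `lam ≤ μ ≤ Lam`
on the unit sphere. -/
def SpecOK (n : ℕ) (lam Lam : ℝ) (μ : EuclideanSpace ℝ (Fin n) → ℝ) : Prop :=
  Measurable μ ∧ ∀ θ : EuclideanSpace ℝ (Fin n), ‖θ‖ = 1 →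
    μ (-θ) = μ θ ∧ lam ≤ μ θ ∧ μ θ ≤ Lam

/-- The linear operator of the class `L_*(s)` with spectral measure `μ`:
`Lu(x) = (1-s) ∫ ((u(x+y)+u(x-y))/2 - u(x)) μ(y/|y|) |y|^{-n-2s} dy`. -/
noncomputable def kerOp (n : ℕ) (s : ℝ) (μ u : EuclideanSpace ℝ (Fin n) → ℝ)
    (x : EuclideanSpace ℝ (Fin n)) : ℝ :=
  (1 - s) * ∫ y : EuclideanSpace ℝ (Fin n),
    ((u (x + y) + u (x - y)) / 2 - u x) * μ (‖y‖⁻¹ • y) / ‖y‖ ^ ((n : ℝ) + 2 * s)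

noncomputable def phiAux (s z : ℝ) : ℝ := ((max (1 + z) 0) ^ s + (max (1 - z) 0) ^ s) / 2 - 1

lemma phiAux_neg (s z : ℝ) : phiAux s (-z) = phiAux s z := by
  unfold phiAux
  rw [sub_neg_eq_add, ← sub_eq_add_neg]; ring

lemma phiAux_abs (s z : ℝ) : phiAux s |z| = phiAux s z := by
  rcases abs_choice z with h | h <;> rw [h]
  exact phiAux_neg s z

lemma phiAux_cont {s : ℝ} (hs0 : 0 < s) : Continuous (phiAux s) := by
  unfold phiAux
  have h1 : Continuous fun z : ℝ => (max (1 + z) 0) ^ s :=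
    Continuous.rpow_const (by fun_prop) (fun _ => Or.inr hs0.le)
  have h2 : Continuous fun z : ℝ => (max (1 - z) 0) ^ s :=
    Continuous.rpow_const (by fun_prop) (fun _ => Or.inr hs0.le)
  fun_prop

lemma rpow_low {s z : ℝ} (hs0 : 0 < s) (hs1 : s < 1) (h0 : -1 ≤ z) (h1 : z ≤ 1) :
    1 + s * z - (1 - s) * z ^ 2 ≤ (1 + z) ^ s := by
  rcases h0.eq_or_lt with rfl | h
  · have : 0 ≤ (1 + (-1:ℝ)) ^ s := Real.rpow_nonneg (by norm_num) _
    linarith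
  · have hp : 0 < 1 + z := by linarith
    have ha : 0 < (1 + z) ^ s := Real.rpow_pos_of_pos hp _
    have hb := rpow_one_add_le_one_add_mul_self h0 (p := 1 - s) (by linarith) (by linarith)
    have hab : (1 + z) ^ s * (1 + z) ^ (1 - s) = 1 + z := by
      rw [← Real.rpow_add hp]; simp
    have e1 : 1 + z ≤ (1 + z) ^ s * (1 + (1 - s) * z) := by
      nlinarith [mul_le_mul_of_nonneg_left hb ha.le]
    have hw : 0 ≤ 1 - (1 - s) * z := by nlinarith
    have e2 := mul_le_mul_of_nonneg_right e1 hw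
    nlinarith [mul_nonneg ha.le (sq_nonneg ((1 - s) * z))]

lemma phiAux_bound_pos {s z : ℝ} (hs0 : 0 < s) (hs1 : s < 1) (hz : 0 ≤ z) :
    |phiAux s z| ≤ min (z ^ 2) (z ^ s) := by
  rcases le_total z 1 with h | h
  · have e1 : z ^ 2 ≤ z ^ s := by
      rw [← Real.rpow_two]
      rcases hz.eq_or_lt with rfl | hz
      · simp [hs0.ne']
      · exact Real.rpow_le_rpow_of_exponent_ge hz h (by linarith)
    rw [min_eq_left e1]
    unfold phiAux
    rw [max_eq_left (by linarith), max_eq_left (by linarith), abs_le]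
    have a1 := rpow_low hs0 hs1 (z := z) (by linarith) h
    have a2 := rpow_low hs0 hs1 (z := -z) (by linarith) (by linarith)
    have a3 := rpow_one_add_le_one_add_mul_self (s := z) (p := s) (by linarith) hs0.le hs1.le
    have a4 := rpow_one_add_le_one_add_mul_self (s := -z) (p := s) (by linarith) hs0.le hs1.le
    rw [← sub_eq_add_neg] at a2 a4
    constructor <;> nlinarith [sq_nonneg z]
  · have e1 : z ^ s ≤ z ^ 2 := by
      rw [← Real.rpow_two]
      exact Real.rpow_le_rpow_of_exponent_le h (by linarith)
    rw [min_eq_right e1]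
    unfold phiAux
    rw [max_eq_left (by linarith), max_eq_right (by linarith), Real.zero_rpow hs0.ne', abs_le]
    have a1 : 1 ≤ z ^ s := Real.one_le_rpow h hs0.le
    have a2 : (1 + z) ^ s ≤ (2 * z) ^ s := Real.rpow_le_rpow (by linarith) (by linarith) hs0.le
    rw [Real.mul_rpow (by norm_num) hz] at a2
    have a3 : (2:ℝ) ^ s ≤ 2 := by
      simpa using Real.rpow_le_rpow_of_exponent_le (x := 2) (by norm_num) hs1.le
    have a4 : 0 ≤ (1 + z) ^ s := by positivity
    constructor <;> nlinarith

lemma phiAux_bound {s z : ℝ} (hs0 : 0 < s) (hs1 : s < 1) :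
    |phiAux s z| ≤ min (z ^ 2) (|z| ^ s) := by
  have := phiAux_bound_pos hs0 hs1 (abs_nonneg z)
  rwa [phiAux_abs, sq_abs] at this

lemma maj_int {s c : ℝ} (hs0 : 0 < s) (hs1 : s < 1) (hc : 0 ≤ c) :
    IntegrableOn (fun r : ℝ => min ((c * r) ^ 2) ((c * r) ^ s) * r ^ (-1 - 2 * s))
      (Set.Ioi 0) := by
  have hcont : ContinuousOn (fun r : ℝ => min ((c * r) ^ 2) ((c * r) ^ s) * r ^ (-1 - 2 * s))
      (Set.Ioi 0) := by
    apply ContinuousOn.mul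
    · apply Continuous.continuousOn
      have : Continuous fun r : ℝ => (c * r) ^ s :=
        Continuous.rpow_const (by fun_prop) (fun _ => Or.inr hs0.le)
      fun_prop
    · exact ContinuousOn.rpow_const continuousOn_id (fun x hx => Or.inl (ne_of_gt hx))
  rw [← Set.Ioc_union_Ioi_eq_Ioi (zero_le_one' ℝ)]
  apply IntegrableOn.union
  · have h1 : IntegrableOn (fun r : ℝ => c ^ 2 * r ^ (1 - 2 * s)) (Set.Ioc 0 1) := by
      have := (intervalIntegral.intervalIntegrable_rpow' (a := 0) (b := 1)
        (show -1 < 1 - 2 * s by linarith)).const_mul (c ^ 2)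
      rwa [intervalIntegrable_iff_integrableOn_Ioc_of_le zero_le_one] at this
    refine Integrable.mono' h1 ((hcont.mono (fun x hx => hx.1)).aestronglyMeasurable
      measurableSet_Ioc) ?_
    refine (ae_restrict_iff' measurableSet_Ioc).2 (Filter.Eventually.of_forall fun r hr => ?_)
    have hr0 : 0 < r := hr.1
    have hk : 0 ≤ r ^ (-1 - 2 * s) := by positivity
    rw [Real.norm_of_nonneg (by positivity)]
    calc _ ≤ (c * r) ^ 2 * r ^ (-1 - 2 * s) := by gcongr; exact min_le_left _ _
      _ = c ^ 2 * (r ^ (2:ℝ) * r ^ (-1 - 2 * s)) := by rw [Real.rpow_two]; ring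
      _ = _ := by rw [← Real.rpow_add hr0]; ring_nf
  · have h1 : IntegrableOn (fun r : ℝ => c ^ s * r ^ (-1 - s)) (Set.Ioi 1) :=
      (integrableOn_Ioi_rpow_of_lt (by linarith) one_pos).const_mul _
    refine Integrable.mono' h1 ((hcont.mono (Set.Ioi_subset_Ioi zero_le_one)).aestronglyMeasurable
      measurableSet_Ioi) ?_
    refine (ae_restrict_iff' measurableSet_Ioi).2 (Filter.Eventually.of_forall fun r hr => ?_)
    have hr0 : 0 < r := lt_trans one_pos hr
    have hk : 0 ≤ r ^ (-1 - 2 * s) := by positivity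
    rw [Real.norm_of_nonneg (by positivity)]
    calc _ ≤ (c * r) ^ s * r ^ (-1 - 2 * s) := by gcongr; exact min_le_right _ _
      _ = c ^ s * (r ^ s * r ^ (-1 - 2 * s)) := by rw [Real.mul_rpow hc hr0.le]; ring
      _ = _ := by rw [← Real.rpow_add hr0]; ring_nf

lemma phi_int {s : ℝ} (hs0 : 0 < s) (hs1 : s < 1) :
    IntegrableOn (fun r : ℝ => phiAux s r * r ^ (-1 - 2 * s)) (Set.Ioi 0) := by
  refine Integrable.mono' (maj_int hs0 hs1 zero_le_one) ?_ ?_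
  · refine ContinuousOn.aestronglyMeasurable ?_ measurableSet_Ioi
    exact (phiAux_cont hs0).continuousOn.mul
      (ContinuousOn.rpow_const continuousOn_id (fun x hx => Or.inl (ne_of_gt hx)))
  · refine (ae_restrict_iff' measurableSet_Ioi).2 (Filter.Eventually.of_forall fun r hr => ?_)
    have hr0 : 0 < r := hr
    have hk : 0 ≤ r ^ (-1 - 2 * s) := by positivity
    rw [norm_mul, Real.norm_of_nonneg hk, one_mul]
    gcongr
    exact phiAux_bound_pos hs0 hs1 hr0.le

lemma tail_sum {s e : ℝ} (hs0 : 0 < s) (hs1 : s < 1) (he : 0 < e) :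
    IntegrableOn (fun r : ℝ => (1 + r) ^ (s - 1) * r ^ (-1 - 2 * s)) (Set.Ioi e) ∧
    IntegrableOn (fun r : ℝ => (1 + r) ^ s * r ^ (-1 - 2 * s)) (Set.Ioi e) ∧
    (∫ r in Set.Ioi e, (1 + r) ^ s * r ^ (-1 - 2 * s)) +
      (∫ r in Set.Ioi e, (1 + r) ^ (s - 1) * r ^ (-1 - 2 * s))
      = (1 / s) * ((1 + e) ^ s * e ^ (-2 * s)) := by
  have hd : ∀ r ∈ Set.Ici e, HasDerivAt (fun r : ℝ => -(1 / s) * ((1 + r) ^ s * r ^ (-2 * s)))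
      ((1 + r) ^ s * r ^ (-1 - 2 * s) + (1 + r) ^ (s - 1) * r ^ (-1 - 2 * s)) r := by
    intro r hr
    have hr0 : 0 < r := lt_of_lt_of_le he hr
    have h1 : HasDerivAt (fun r : ℝ => (1 + r) ^ s) (1 * s * (1 + r) ^ (s - 1)) r :=
      ((hasDerivAt_id r).const_add 1).rpow_const (Or.inl (by simp; positivity))
    have h2 := Real.hasDerivAt_rpow_const (x := r) (p := -2 * s) (Or.inl hr0.ne')
    refine ((h1.mul h2).const_mul (-(1 / s))).congr_deriv ?_
    have e1 : (1 + r) ^ s = (1 + r) ^ (s - 1) * (1 + r) := by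
      rw [← Real.rpow_add_one (by positivity)]; simp
    have e2 : r ^ (-2 * s) = r ^ (-1 - 2 * s) * r := by
      rw [← Real.rpow_add_one (by positivity)]; ring_nf
    have e3 : (-2 * s - 1) = -1 - 2 * s := by ring
    rw [e3, e1, e2]
    field_simp
    ring
  have hl : Filter.Tendsto (fun r : ℝ => -(1 / s) * ((1 + r) ^ s * r ^ (-2 * s))) Filter.atTop
      (nhds 0) := by
    have h1 : Filter.Tendsto (fun r : ℝ => 2 * r ^ (-s)) Filter.atTop (nhds 0) := by
      simpa using (tendsto_rpow_neg_atTop hs0).const_mul 2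
    have h2 : Filter.Tendsto (fun r : ℝ => (1 + r) ^ s * r ^ (-2 * s)) Filter.atTop (nhds 0) := by
      refine tendsto_of_tendsto_of_tendsto_of_le_of_le' tendsto_const_nhds h1 ?_ ?_
      · filter_upwards [Filter.eventually_ge_atTop 1] with r hr
        positivity
      · filter_upwards [Filter.eventually_ge_atTop 1] with r hr
        have hr0 : 0 < r := by linarith
        have a2 : (1 + r) ^ s ≤ (2 * r) ^ s :=
          Real.rpow_le_rpow (by linarith) (by linarith) hs0.le
        rw [Real.mul_rpow (by norm_num) hr0.le] at a2
        have a3 : (2:ℝ) ^ s ≤ 2 := by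
          simpa using Real.rpow_le_rpow_of_exponent_le (x := 2) (by norm_num) hs1.le
        calc (1 + r) ^ s * r ^ (-2 * s) ≤ (2 * r ^ s) * r ^ (-2 * s) := by
              gcongr
              exact a2.trans (by gcongr)
          _ = 2 * (r ^ s * r ^ (-2 * s)) := by ring
          _ = _ := by rw [← Real.rpow_add hr0]; ring_nf
    simpa using h2.const_mul (-(1 / s))
  have hpos : ∀ r ∈ Set.Ioi e, 0 ≤
      ((1 + r) ^ s * r ^ (-1 - 2 * s) + (1 + r) ^ (s - 1) * r ^ (-1 - 2 * s)) := by
    intro r hr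
    have hr0 : 0 < r := lt_trans he hr
    positivity
  have hI := integrableOn_Ioi_deriv_of_nonneg' hd hpos hl
  have hV := integral_Ioi_of_hasDerivAt_of_nonneg' hd hpos hl
  have hB : IntegrableOn (fun r : ℝ => (1 + r) ^ (s - 1) * r ^ (-1 - 2 * s)) (Set.Ioi e) := by
    refine Integrable.mono' (integrableOn_Ioi_rpow_of_lt (a := -1 - 2 * s) (by linarith) he) ?_ ?_
    · refine ContinuousOn.aestronglyMeasurable ?_ measurableSet_Ioi
      refine ContinuousOn.mul ?_ ?_
      · refine ContinuousOn.rpow_const (by fun_prop) (fun x hx => Or.inl ?_)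
        have : 0 < x := lt_trans he hx
        positivity
      · refine ContinuousOn.rpow_const (by fun_prop) (fun x hx => Or.inl ?_)
        exact (lt_trans he hx).ne'
    · refine (ae_restrict_iff' measurableSet_Ioi).2 (Filter.Eventually.of_forall fun r hr => ?_)
      have hr0 : 0 < r := lt_trans he hr
      rw [Real.norm_of_nonneg (by positivity)]
      have : (1 + r) ^ (s - 1) ≤ 1 :=
        Real.rpow_le_one_of_one_le_of_nonpos (by linarith) (by linarith)
      have hk : 0 ≤ r ^ (-1 - 2 * s) := by positivity
      nlinarith
  have hA : IntegrableOn (fun r : ℝ => (1 + r) ^ s * r ^ (-1 - 2 * s)) (Set.Ioi e) := by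
    refine (hI.sub hB).congr (Filter.Eventually.of_forall fun r => ?_)
    simp
  refine ⟨hB, hA, ?_⟩
  rw [← integral_add hA hB, hV]
  ring

lemma changeVar {s e : ℝ} (he : 0 < e) (he1 : e < 1) :
    (∫ r in Set.Ioo e 1, (1 - r) ^ s * r ^ (-1 - 2 * s)) =
      ∫ r in Set.Ioi (e / (1 - e)), (1 + r) ^ (s - 1) * r ^ (-1 - 2 * s) := by
  have himg : (fun r : ℝ => r / (1 - r)) '' Set.Ioo e 1 = Set.Ioi (e / (1 - e)) := by
    ext y
    constructor
    · rintro ⟨r, ⟨h1, h2⟩, rfl⟩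
      simp only [Set.mem_Ioi]
      rw [div_lt_div_iff₀ (by linarith) (by linarith)]
      nlinarith
    · intro hy
      have hy : e / (1 - e) < y := hy
      have hy0 : 0 < y := lt_trans (div_pos he (by linarith)) hy
      rw [div_lt_iff₀ (by linarith)] at hy
      refine ⟨y / (1 + y), ⟨?_, ?_⟩, ?_⟩
      · rw [lt_div_iff₀ (by linarith)]; nlinarith
      · rw [div_lt_one (by linarith)]; linarith
      · have : (1 + y) ≠ 0 := by positivity
        have h3 : 1 - y / (1 + y) = 1 / (1 + y) := by field_simp; ring
        simp only [h3]
        field_simp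
  have hinj : Set.InjOn (fun r : ℝ => r / (1 - r)) (Set.Ioo e 1) := by
    intro a ha b hb hab
    have h1 : (1 - a) ≠ 0 := by linarith [ha.2]
    have h2 : (1 - b) ≠ 0 := by linarith [hb.2]
    simp only at hab
    rw [div_eq_div_iff h1 h2] at hab
    linarith
  have hder : ∀ r ∈ Set.Ioo e 1, HasDerivWithinAt (fun r : ℝ => r / (1 - r))
      (1 / (1 - r) ^ 2) (Set.Ioo e 1) r := by
    intro r hr
    have h1 : (1 - r) ≠ 0 := by linarith [hr.2]
    have := ((hasDerivAt_id r).div ((hasDerivAt_id r).const_sub 1) h1).hasDerivWithinAt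
      (s := Set.Ioo e 1)
    refine this.congr_deriv ?_
    simp
  rw [← himg, integral_image_eq_integral_abs_deriv_smul measurableSet_Ioo hder hinj]
  refine setIntegral_congr_fun measurableSet_Ioo fun r hr => ?_
  have h1 : 0 < 1 - r := by linarith [hr.2]
  have h0 : 0 < r := lt_trans he hr.1
  have h3 : 1 + r / (1 - r) = (1 - r)⁻¹ := by field_simp; ring
  simp only [h3, smul_eq_mul]
  rw [abs_of_pos (by positivity), Real.inv_rpow h1.le, ← Real.rpow_neg h1.le, div_eq_mul_inv r,
    Real.mul_rpow h0.le (by positivity), Real.inv_rpow h1.le, ← Real.rpow_neg h1.le, one_div,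
    ← Real.rpow_two, ← Real.rpow_neg h1.le]
  have : (1 - r) ^ s = (1 - r) ^ (-2 : ℝ) * (1 - r) ^ (-(s - 1)) * (1 - r) ^ (-(-1 - 2 * s)) := by
    rw [← Real.rpow_add h1, ← Real.rpow_add h1]; ring_nf
  rw [this]
  ring

lemma core_e {s e : ℝ} (hs0 : 0 < s) (hs1 : s < 1) (he : 0 < e) (he1 : e < 1) :
    2 * ∫ r in Set.Ioi e, phiAux s r * r ^ (-1 - 2 * s) =
      (∫ r in Set.Ioc e (e / (1 - e)), (1 + r) ^ s * r ^ (-1 - 2 * s)) -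
        (1 / s) * e ^ (-2 * s) * (1 - (1 - e) ^ s) := by
  have hd : 0 < 1 - e := by linarith
  have hee : e ≤ e / (1 - e) := by rw [le_div_iff₀ hd]; nlinarith
  have he' : 0 < e / (1 - e) := by positivity
  obtain ⟨-, hA, -⟩ := tail_sum hs0 hs1 he
  obtain ⟨-, hA', hsum⟩ := tail_sum hs0 hs1 he'
  have hC := integrableOn_Ioi_rpow_of_lt (a := -1 - 2 * s) (by linarith) he
  have hCv := integral_Ioi_rpow_of_lt (a := -1 - 2 * s) (by linarith) he
  have hB : IntegrableOn (fun r : ℝ => (max (1 - r) 0) ^ s * r ^ (-1 - 2 * s)) (Set.Ioi e) := by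
    refine Integrable.mono' hC ?_ ?_
    · refine ContinuousOn.aestronglyMeasurable ?_ measurableSet_Ioi
      refine ContinuousOn.mul ?_ ?_
      · exact ContinuousOn.rpow_const (by fun_prop) (fun x hx => Or.inr hs0.le)
      · refine ContinuousOn.rpow_const (by fun_prop) (fun x hx => Or.inl ?_)
        exact (lt_trans he hx).ne'
    · refine (ae_restrict_iff' measurableSet_Ioi).2 (Filter.Eventually.of_forall fun r hr => ?_)
      have hr0 : 0 < r := lt_trans he hr
      rw [Real.norm_of_nonneg (by positivity)]
      have : (max (1 - r) 0) ^ s ≤ 1 :=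
        Real.rpow_le_one (by positivity) (max_le (by linarith) zero_le_one) hs0.le
      have hk : 0 ≤ r ^ (-1 - 2 * s) := by positivity
      nlinarith
  have hBv : (∫ r in Set.Ioi e, (max (1 - r) 0) ^ s * r ^ (-1 - 2 * s)) =
      ∫ r in Set.Ioo e 1, (1 - r) ^ s * r ^ (-1 - 2 * s) := by
    have h1 : (∫ r in Set.Ioi e, (max (1 - r) 0) ^ s * r ^ (-1 - 2 * s)) =
      ∫ r in Set.Ioo e 1, (max (1 - r) 0) ^ s * r ^ (-1 - 2 * s) := by
      refine setIntegral_eq_of_subset_of_forall_sdiff_eq_zero measurableSet_Ioi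
        Set.Ioo_subset_Ioi_self ?_
      intro r hr
      have : 1 ≤ r := by
        by_contra h
        exact hr.2 ⟨hr.1, not_le.1 h⟩
      rw [max_eq_right (by linarith), Real.zero_rpow hs0.ne', zero_mul]
    rw [h1]
    refine setIntegral_congr_fun measurableSet_Ioo fun r hr => ?_
    rw [max_eq_left (by linarith [hr.2])]
  have hsplit : (∫ r in Set.Ioi e, (1 + r) ^ s * r ^ (-1 - 2 * s)) =
      (∫ r in Set.Ioc e (e / (1 - e)), (1 + r) ^ s * r ^ (-1 - 2 * s)) +
      ∫ r in Set.Ioi (e / (1 - e)), (1 + r) ^ s * r ^ (-1 - 2 * s) := by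
    rw [← setIntegral_union Set.Ioc_disjoint_Ioi_same measurableSet_Ioi
      (hA.mono_set Set.Ioc_subset_Ioi_self) hA', Set.Ioc_union_Ioi_eq_Ioi hee]
  have hmain : 2 * ∫ r in Set.Ioi e, phiAux s r * r ^ (-1 - 2 * s) =
      (∫ r in Set.Ioi e, (1 + r) ^ s * r ^ (-1 - 2 * s)) +
      (∫ r in Set.Ioi e, (max (1 - r) 0) ^ s * r ^ (-1 - 2 * s)) -
      2 * ∫ r in Set.Ioi e, r ^ (-1 - 2 * s) := by
    rw [← integral_add hA hB, ← integral_const_mul, ← integral_const_mul,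
      ← integral_sub (Integrable.fun_add hA hB) (hC.const_mul 2)]
    refine setIntegral_congr_fun measurableSet_Ioi fun r hr => ?_
    have hr0 : 0 < r := lt_trans he hr
    simp only [phiAux]
    rw [max_eq_left (a := 1 + r) (by linarith)]
    ring
  rw [hmain, hBv, changeVar he he1, hsplit, hCv]
  have h3 : 1 + e / (1 - e) = (1 - e)⁻¹ := by field_simp; ring
  have h4 : (1 + e / (1 - e)) ^ s * (e / (1 - e)) ^ (-2 * s) = (1 - e) ^ s * e ^ (-2 * s) := by
    rw [h3, div_eq_mul_inv e, Real.mul_rpow he.le (by positivity), Real.inv_rpow hd.le,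
      Real.inv_rpow hd.le, ← Real.rpow_neg hd.le, ← Real.rpow_neg hd.le]
    have : (1 - e) ^ s = (1 - e) ^ (-s) * (1 - e) ^ (-(-2 * s)) := by
      rw [← Real.rpow_add hd]; ring_nf
    rw [this]; ring
  rw [h4] at hsum
  have h5 : -1 - 2 * s + 1 = -2 * s := by ring
  rw [h5]
  have h6 : -e ^ (-2 * s) / (-2 * s) = (1 / s) * e ^ (-2 * s) / 2 := by field_simp
  rw [h6]
  linarith

lemma core_est {s e : ℝ} (hs0 : 0 < s) (hs1 : s < 1) (he : 0 < e) (he1 : e ≤ 1 / 2) :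
    |2 * ∫ r in Set.Ioi e, phiAux s r * r ^ (-1 - 2 * s)| ≤ (10 + 1 / s) * e ^ (2 - 2 * s) := by
  rw [core_e hs0 hs1 he (by linarith)]
  have hd : 0 < 1 - e := by linarith
  have hd1 : 1 - e ≤ 1 := by linarith
  have hee : e ≤ e / (1 - e) := by rw [le_div_iff₀ hd]; nlinarith
  have he' : 0 < e / (1 - e) := by positivity
  obtain ⟨-, hA, -⟩ := tail_sum hs0 hs1 he
  have hA := hA.mono_set (fun r (hr : r ∈ Set.Ioc e (e / (1 - e))) => hr.1)
  set q := e ^ (-1 - 2 * s) with hq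
  have hq0 : 0 < q := by positivity
  have hconst : ∀ c : ℝ, ∫ r in Set.Ioc e (e / (1 - e)), c = c * (e ^ 2 / (1 - e)) := by
    intro c
    rw [setIntegral_const, measureReal_def, Real.volume_Ioc,
      ENNReal.toReal_ofReal (by linarith), smul_eq_mul]
    field_simp
    ring
  have hci : ∀ c : ℝ, IntegrableOn (fun _ : ℝ => c) (Set.Ioc e (e / (1 - e))) := fun c =>
    integrableOn_const (by simp)
  have hup : (∫ r in Set.Ioc e (e / (1 - e)), (1 + r) ^ s * r ^ (-1 - 2 * s)) ≤
      ((1 - e)⁻¹ * q) * (e ^ 2 / (1 - e)) := by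
    rw [← hconst]
    refine setIntegral_mono_on hA (hci _) measurableSet_Ioc fun r hr => ?_
    have hr0 : 0 < r := lt_trans he hr.1
    have h1 : r ^ (-1 - 2 * s) ≤ q :=
      Real.rpow_le_rpow_of_nonpos he hr.1.le (by linarith)
    have h2 : (1 + r) ^ s ≤ (1 - e)⁻¹ := by
      have h3 : 1 + e / (1 - e) = (1 - e)⁻¹ := by field_simp; ring
      have h4 : (1 + r) ^ s ≤ (1 + r) ^ (1:ℝ) :=
        Real.rpow_le_rpow_of_exponent_le (by linarith) hs1.le
      rw [Real.rpow_one] at h4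
      linarith [hr.2]
    gcongr
  have hlow : ((1 - e) ^ 3 * q) * (e ^ 2 / (1 - e)) ≤
      (∫ r in Set.Ioc e (e / (1 - e)), (1 + r) ^ s * r ^ (-1 - 2 * s)) := by
    rw [← hconst]
    refine setIntegral_mono_on (hci _) hA measurableSet_Ioc fun r hr => ?_
    have hr0 : 0 < r := lt_trans he hr.1
    have h1 : (e / (1 - e)) ^ (-1 - 2 * s) ≤ r ^ (-1 - 2 * s) :=
      Real.rpow_le_rpow_of_nonpos hr0 hr.2 (by linarith)
    have h2 : 1 ≤ (1 + r) ^ s := Real.one_le_rpow (by linarith) hs0.le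
    have h3 : (e / (1 - e)) ^ (-1 - 2 * s) = (1 - e) ^ (1 + 2 * s) * q := by
      rw [div_eq_mul_inv e, Real.mul_rpow he.le (by positivity),
        Real.inv_rpow hd.le, ← Real.rpow_neg hd.le, hq]
      ring_nf
    have h4 : (1 - e) ^ 3 ≤ (1 - e) ^ (1 + 2 * s) := by
      rw [← Real.rpow_natCast]
      exact Real.rpow_le_rpow_of_exponent_ge hd hd1 (by norm_num; linarith)
    calc (1 - e) ^ 3 * q ≤ (1 - e) ^ (1 + 2 * s) * q := by gcongr
      _ = 1 * (e / (1 - e)) ^ (-1 - 2 * s) := by rw [h3, one_mul]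
      _ ≤ _ := by gcongr
  have b1 := rpow_low hs0 hs1 (z := -e) (by linarith) (by linarith)
  have b2 := rpow_one_add_le_one_add_mul_self (s := -e) (p := s) (by linarith) hs0.le hs1.le
  rw [← sub_eq_add_neg] at b1 b2
  have hqe : e ^ (-2 * s) = q * e := by
    rw [hq, ← Real.rpow_add_one he.ne']; ring_nf
  have hqe3 : e ^ (2 - 2 * s) = q * e ^ 3 := by
    rw [hq, ← Real.rpow_natCast, ← Real.rpow_add he]; norm_num; ring_nf
  rw [hqe, hqe3]
  set J := ∫ r in Set.Ioc e (e / (1 - e)), (1 + r) ^ s * r ^ (-1 - 2 * s)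
  have hJ1 : J ≤ q * e ^ 2 * (1 + 6 * e) := by
    refine hup.trans ?_
    have : (1 - e)⁻¹ * (1 - e)⁻¹ ≤ 1 + 6 * e := by
      rw [← mul_inv, inv_le_iff_one_le_mul₀ (by positivity)]
      nlinarith [mul_nonneg he.le (mul_nonneg (show 0 ≤ 1 - 2 * e by linarith)
        (show 0 ≤ 4 - 3 * e by linarith))]
    calc (1 - e)⁻¹ * q * (e ^ 2 / (1 - e)) = q * e ^ 2 * ((1 - e)⁻¹ * (1 - e)⁻¹) := by
          field_simp
      _ ≤ _ := by gcongr
  have hJ2 : q * e ^ 2 * (1 - 2 * e) ≤ J := by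
    refine le_trans ?_ hlow
    calc q * e ^ 2 * (1 - 2 * e) ≤ q * e ^ 2 * ((1 - e) ^ 2) := by
          gcongr; nlinarith
      _ = _ := by field_simp
  have hT1 : q * e ^ 2 ≤ 1 / s * (q * e) * (1 - (1 - e) ^ s) := by
    calc q * e ^ 2 = 1 / s * (q * e) * (s * e) := by field_simp
      _ ≤ _ := by gcongr; linarith
  have hT2 : 1 / s * (q * e) * (1 - (1 - e) ^ s) ≤ q * e ^ 2 * (1 + 1 / s * e) := by
    calc _ ≤ 1 / s * (q * e) * (s * e + 1 * e ^ 2) := by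
          gcongr; nlinarith [sq_nonneg e]
      _ = _ := by field_simp
  have hp : 0 < q * e ^ 3 := by positivity
  have hp2 : 0 < 1 / s * (q * e ^ 3) := by positivity
  rw [abs_le]
  constructor <;> nlinarith

lemma core {s : ℝ} (hs0 : 0 < s) (hs1 : s < 1) :
    ∫ r in Set.Ioi (0:ℝ), phiAux s r * r ^ (-1 - 2 * s) = 0 := by
  have hun : (⋃ k : ℕ, Set.Ioi (1 / ((k : ℝ) + 1))) = Set.Ioi (0:ℝ) := by
    ext y
    simp only [Set.mem_iUnion, Set.mem_Ioi]
    constructor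
    · rintro ⟨k, hk⟩
      exact lt_trans (by positivity) hk
    · intro hy
      exact exists_nat_one_div_lt hy
  have hmono : Monotone fun k : ℕ => Set.Ioi (1 / ((k : ℝ) + 1)) := by
    intro a b hab
    exact Set.Ioi_subset_Ioi (one_div_le_one_div_of_le (by positivity) (by gcongr))
  have h1 := tendsto_setIntegral_of_monotone (μ := volume)
    (f := fun r : ℝ => phiAux s r * r ^ (-1 - 2 * s))
    (fun k : ℕ => (measurableSet_Ioi : MeasurableSet (Set.Ioi (1 / ((k : ℝ) + 1))))) hmono
    (by rw [hun]; exact phi_int hs0 hs1)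
  rw [hun] at h1
  have h2 : Filter.Tendsto (fun k : ℕ => 2 * ∫ r in Set.Ioi (1 / ((k : ℝ) + 1)),
      phiAux s r * r ^ (-1 - 2 * s)) Filter.atTop (nhds 0) := by
    have h3 : Filter.Tendsto (fun k : ℕ => (10 + 1 / s) * (1 / ((k : ℝ) + 1)) ^ (2 - 2 * s))
        Filter.atTop (nhds 0) := by
      have := (tendsto_one_div_add_atTop_nhds_zero_nat (𝕜 := ℝ)).rpow_const (p := 2 - 2 * s)
        (Or.inr (by linarith))
      rw [Real.zero_rpow (by linarith)] at this
      simpa using this.const_mul (10 + 1 / s)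
    refine squeeze_zero_norm' ?_ h3
    filter_upwards [Filter.eventually_ge_atTop 1] with k hk
    have hk' : (1:ℝ) ≤ k := by exact_mod_cast hk
    exact core_est hs0 hs1 (by positivity)
      (one_div_le_one_div_of_le (by norm_num) (by linarith))
  have h4 := tendsto_nhds_unique (h1.const_mul 2) h2
  linarith

lemma core_c {s : ℝ} (hs0 : 0 < s) (hs1 : s < 1) (c : ℝ) :
    ∫ r in Set.Ioi (0:ℝ), phiAux s (c * r) * r ^ (-1 - 2 * s) = 0 := by
  rcases eq_or_ne c 0 with rfl | hc
  · simp [phiAux]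
  · have hc' : 0 < |c| := abs_pos.2 hc
    have h := integral_comp_mul_left_Ioi (fun r => phiAux s r * r ^ (-1 - 2 * s)) 0 hc'
    rw [mul_zero, core hs0 hs1, smul_zero] at h
    have h2 : ∫ r in Set.Ioi (0:ℝ), phiAux s (|c| * r) * (|c| * r) ^ (-1 - 2 * s) =
        |c| ^ (-1 - 2 * s) * ∫ r in Set.Ioi (0:ℝ), phiAux s (c * r) * r ^ (-1 - 2 * s) := by
      rw [← integral_const_mul]
      refine setIntegral_congr_fun measurableSet_Ioi fun r hr => ?_
      have hr0 : 0 < r := hr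
      rw [Real.mul_rpow hc'.le hr0.le, ← phiAux_abs s (c * r), abs_mul, abs_of_pos hr0]
      ring
    rw [h2] at h
    exact (mul_eq_zero.1 h).resolve_left (by positivity)

lemma integral_polar_zero (n : ℕ) (hn : 1 ≤ n) (F : EuclideanSpace ℝ (Fin n) → ℝ)
    (hF : Integrable F)
    (h : ∀ θ : EuclideanSpace ℝ (Fin n), ‖θ‖ = 1 →
      ∫ r in Set.Ioi (0:ℝ), r ^ (n - 1) * F (r • θ) = 0) : ∫ y, F y = 0 := by
  have : Nonempty (Fin n) := ⟨⟨0, hn⟩⟩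
  have : Nontrivial (EuclideanSpace ℝ (Fin n)) := inferInstance
  have hmp := (volume : Measure (EuclideanSpace ℝ (Fin n))).measurePreserving_homeomorphUnitSphereProd
  have hdim : Module.finrank ℝ (EuclideanSpace ℝ (Fin n)) = n := by simp
  rw [hdim] at hmp
  set G : Metric.sphere (0 : EuclideanSpace ℝ (Fin n)) 1 × Set.Ioi (0:ℝ) → ℝ :=
    fun p => F (p.2.1 • p.1.1) with hG
  have hGc : ∀ x : ({0}ᶜ : Set (EuclideanSpace ℝ (Fin n))),
      G (homeomorphUnitSphereProd _ x) = F x.1 := by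
    intro x
    have hx : ‖x.1‖ ≠ 0 := norm_ne_zero_iff.2 x.2
    simp [hG, smul_smul, hx]
  have hme := (homeomorphUnitSphereProd (EuclideanSpace ℝ (Fin n))).measurableEmbedding
  have h1 : ∫ y, F y = ∫ p, G p ∂((volume : Measure (EuclideanSpace ℝ (Fin n))).toSphere.prod
      (.volumeIoiPow (n - 1))) := by
    rw [← hmp.integral_comp hme]
    simp only [hGc]
    rw [integral_subtype_comap (measurableSet_singleton _).compl fun x ↦ F x,
        restrict_compl_singleton]
  have hGi : Integrable G ((volume : Measure (EuclideanSpace ℝ (Fin n))).toSphere.prod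
      (.volumeIoiPow (n - 1))) := by
    rw [← hmp.integrable_comp_emb hme]
    have : G ∘ (homeomorphUnitSphereProd (EuclideanSpace ℝ (Fin n))) = F ∘ Subtype.val := by
      ext x; exact hGc x
    rw [this, ← integrableOn_iff_comap_subtypeVal (measurableSet_singleton _).compl]
    exact hF.integrableOn
  rw [h1, integral_prod _ hGi]
  refine integral_eq_zero_of_ae (Filter.Eventually.of_forall fun θ => ?_)
  have hθ : ‖θ.1‖ = 1 := by simp
  simp only [hG, Measure.volumeIoiPow, ENNReal.ofReal, Pi.zero_apply]
  rw [integral_withDensity_eq_integral_smul]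
  · refine Eq.trans ?_ (h θ.1 hθ)
    refine (integral_subtype_comap (μ := volume) (measurableSet_Ioi (a := (0:ℝ)))
      fun a : ℝ ↦ Real.toNNReal (a ^ (n - 1)) • F (a • θ.1)).trans ?_
    refine setIntegral_congr_fun measurableSet_Ioi fun x hx ↦ ?_
    rw [NNReal.smul_def, Real.coe_toNNReal _ (pow_nonneg (le_of_lt hx) _), smul_eq_mul]
  · exact (measurable_subtype_coe.pow_const _).real_toNNReal

lemma kernel_rpow {n : ℕ} (hn : 1 ≤ n) {s r : ℝ} (hr : 0 < r) :
    r ^ (n - 1) / r ^ ((n:ℝ) + 2 * s) = r ^ (-1 - 2 * s) := by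
  rw [← Real.rpow_natCast, ← Real.rpow_sub hr]
  congr 1
  push_cast [hn]
  ring

/-- For any unit vector `ν`, the function `φ_ν^s(x) = ((x·ν)_+)^s` satisfies `Lφ_ν^s = 0`
in `{x·ν > 0}` for every operator `L ∈ L_*(s)` (with absolutely convergent integral). -/
theorem stmt5 (n : ℕ) (hn : 1 ≤ n) (s lam Lam : ℝ) (hs0 : 0 < s) (hs1 : s < 1)
    (hlam : 0 < lam) (hlL : lam ≤ Lam)
    (ν : EuclideanSpace ℝ (Fin n)) (hν : ‖ν‖ = 1)
    (μ : EuclideanSpace ℝ (Fin n) → ℝ) (hμ : SpecOK n lam Lam μ)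
    (x : EuclideanSpace ℝ (Fin n)) (hx : 0 < ⟪x, ν⟫) :
    Integrable (fun y : EuclideanSpace ℝ (Fin n) =>
        (((max ⟪x + y, ν⟫ 0) ^ s + (max ⟪x - y, ν⟫ 0) ^ s) / 2 - (max ⟪x, ν⟫ 0) ^ s)
          * μ (‖y‖⁻¹ • y) / ‖y‖ ^ ((n : ℝ) + 2 * s)) ∧
      kerOp n s μ (fun z => (max ⟪z, ν⟫ 0) ^ s) x = 0 := by
  have : Nonempty (Fin n) := ⟨⟨0, hn⟩⟩
  have : Nontrivial (EuclideanSpace ℝ (Fin n)) := inferInstance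
  obtain ⟨hμm, hμ⟩ := hμ
  set t : ℝ := ⟪x, ν⟫ with ht
  have hdelta : ∀ y : EuclideanSpace ℝ (Fin n),
      ((max ⟪x + y, ν⟫ 0) ^ s + (max ⟪x - y, ν⟫ 0) ^ s) / 2 - (max t 0) ^ s =
        t ^ s * phiAux s (t⁻¹ * ⟪y, ν⟫) := by
    intro y
    have e : ∀ w : ℝ, (max (t + w) 0) ^ s = t ^ s * (max (1 + t⁻¹ * w) 0) ^ s := by
      intro w
      rw [← Real.mul_rpow hx.le (le_max_right _ _), mul_max_of_nonneg _ _ hx.le]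
      congr 2
      · field_simp
      · simp
    rw [inner_add_left, inner_sub_left, ← ht, e, sub_eq_add_neg t, e, max_eq_left hx.le]
    unfold phiAux
    rw [mul_neg, ← sub_eq_add_neg]
    ring
  have hint : Integrable (fun y : EuclideanSpace ℝ (Fin n) =>
        (((max ⟪x + y, ν⟫ 0) ^ s + (max ⟪x - y, ν⟫ 0) ^ s) / 2 - (max t 0) ^ s)
          * μ (‖y‖⁻¹ • y) / ‖y‖ ^ ((n : ℝ) + 2 * s)) := by
    simp only [hdelta]
    have hmaj : Integrable (fun y : EuclideanSpace ℝ (Fin n) =>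
        (fun r : ℝ => t ^ s * Lam * (min ((t⁻¹ * r) ^ 2) ((t⁻¹ * r) ^ s) /
          r ^ ((n:ℝ) + 2 * s))) ‖y‖) := by
      refine (integrable_fun_norm_addHaar (volume : Measure (EuclideanSpace ℝ (Fin n)))
        (f := fun r : ℝ => t ^ s * Lam * (min ((t⁻¹ * r) ^ 2) ((t⁻¹ * r) ^ s) /
          r ^ ((n:ℝ) + 2 * s)))).2 ?_
      have hdim : Module.finrank ℝ (EuclideanSpace ℝ (Fin n)) = n := by simp
      rw [hdim]
      refine IntegrableOn.congr_fun ((maj_int hs0 hs1 (c := t⁻¹) (by positivity)).const_mul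
        (t ^ s * Lam)) (fun r hr => ?_) measurableSet_Ioi
      simp only [smul_eq_mul]
      rw [← kernel_rpow hn hr]
      ring
    refine hmaj.mono' ?_ ?_
    · have hm1 := (phiAux_cont hs0).measurable
      apply Measurable.aestronglyMeasurable
      apply Measurable.div
      · apply Measurable.mul
        · exact (hm1.comp (by fun_prop)).const_mul _
        · exact hμm.comp (by fun_prop)
      · fun_prop
    · have hae : ∀ᵐ y : EuclideanSpace ℝ (Fin n), y ≠ 0 := by
        rw [ae_iff]; simp
      filter_upwards [hae] with y hy
      have hy0 : 0 < ‖y‖ := norm_pos_iff.2 hy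
      obtain ⟨-, m1, m2⟩ := hμ (‖y‖⁻¹ • y) (by simp [norm_smul, hy0.ne'])
      have hts : 0 ≤ t ^ s := by positivity
      rw [norm_div, norm_mul, norm_mul, Real.norm_of_nonneg hts,
        Real.norm_of_nonneg (hlam.le.trans m1), Real.norm_eq_abs,
        Real.norm_of_nonneg (r := ‖y‖ ^ ((n:ℝ) + 2 * s)) (by positivity)]
      have hin : |t⁻¹ * ⟪y, ν⟫| ≤ t⁻¹ * ‖y‖ := by
        rw [abs_mul, abs_of_pos (inv_pos.2 hx)]
        have := abs_real_inner_le_norm y ν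
        rw [hν, mul_one] at this
        gcongr
      have hb : |phiAux s (t⁻¹ * ⟪y, ν⟫)| ≤ min ((t⁻¹ * ‖y‖) ^ 2) ((t⁻¹ * ‖y‖) ^ s) := by
        refine (phiAux_bound hs0 hs1).trans (min_le_min ?_ ?_)
        · rw [← sq_abs]; gcongr
        · gcongr
      have hL : 0 < Lam := by linarith
      calc t ^ s * |phiAux s (t⁻¹ * ⟪y, ν⟫)| * μ (‖y‖⁻¹ • y) / ‖y‖ ^ ((n:ℝ) + 2 * s)
          ≤ t ^ s * (min ((t⁻¹ * ‖y‖) ^ 2) ((t⁻¹ * ‖y‖) ^ s)) * Lam / ‖y‖ ^ ((n:ℝ) + 2 * s) := by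
            gcongr
            exact hlam.le.trans m1
        _ = _ := by ring
  refine ⟨hint, ?_⟩
  unfold kerOp
  refine mul_eq_zero_of_right _ (integral_polar_zero n hn _ hint ?_)
  intro θ hθ
  have hc := core_c hs0 hs1 (t⁻¹ * ⟪θ, ν⟫)
  have hc2 : ∫ r in Set.Ioi (0:ℝ), t ^ s * μ θ * (phiAux s (t⁻¹ * ⟪θ, ν⟫ * r) *
      r ^ (-1 - 2 * s)) = 0 := by
    rw [integral_const_mul, hc, mul_zero]
  refine Eq.trans ?_ hc2
  refine setIntegral_congr_fun measurableSet_Ioi fun r hr => ?_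
  have hr0 : 0 < r := hr
  simp only [← ht, hdelta]
  rw [norm_smul, hθ, Real.norm_of_nonneg hr0.le, mul_one, smul_smul, inv_mul_cancel₀ hr0.ne',
    one_smul, real_inner_smul_left, ← kernel_rpow hn hr0]
  ring_nf
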